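/- Let G be a finite simple graph. If G is (P3∪P2)-free, W4-free and K5-free, then χ(G) ≤ 8. -/

import Mathlib

open SimpleGraph

/-- `P3 ∪ P2`: disjoint union of a path on 3 vertices (0-1-2) and an edge (3-4). -/
def P3P2 : SimpleGraph (Fin 5) :=
  SimpleGraph.fromEdgeSet {s(0,1), s(1,2), s(3,4)}

/-- `W4`: wheel on 5 vertices; 4-cycle 0-1-2-3-0 plus hub 4 adjacent to all. -/
def W4 : SimpleGraph (Fin 5) :=
  SimpleGraph.fromEdgeSet {s(0,1), s(1,2), s(2,3), s(3,0), s(4,0), s(4,1), s(4,2), s(4,3)}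

/-- First-order form of being `P3 ∪ P2`-free. -/
def PFree {V : Type*} (G : SimpleGraph V) : Prop :=
  ∀ x y z u v, G.Adj x y → G.Adj y z → x ≠ z → ¬ G.Adj x z → G.Adj u v →
    ¬ G.Adj x u → ¬ G.Adj x v → ¬ G.Adj y u → ¬ G.Adj y v → ¬ G.Adj z u → ¬ G.Adj z v → False

/-- First-order form of being `W4`-free. -/
def WFree {V : Type*} (G : SimpleGraph V) : Prop :=
  ∀ p q r s h, G.Adj p q → G.Adj q r → G.Adj r s → G.Adj s p → p ≠ r → q ≠ s →
    ¬ G.Adj p r → ¬ G.Adj q s → G.Adj h p → G.Adj h q → G.Adj h r → G.Adj h s → False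

/-- First-order form of being `K5`-free. -/
def KFree {V : Type*} (G : SimpleGraph V) : Prop :=
  ∀ p q r s t, G.Adj p q → G.Adj p r → G.Adj p s → G.Adj p t → G.Adj q r → G.Adj q s →
    G.Adj q t → G.Adj r s → G.Adj r t → G.Adj s t → False

theorem pfree_of {V : Type*} (G : SimpleGraph V) (hP : IsEmpty (P3P2 ↪g G)) : PFree G := by
  intro x y z u v h1 h2 h3 h4 h5 h6 h7 h8 h9 h10 h11
  refine hP.elim ⟨⟨![x, y, z, u, v], ?_⟩, ?_⟩
  · have a1 : x ≠ u := fun h => h7 (h ▸ h5)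
    have a2 : x ≠ v := fun h => h6 (h ▸ h5.symm)
    have a3 : y ≠ u := fun h => h9 (h ▸ h5)
    have a4 : y ≠ v := fun h => h8 (h ▸ h5.symm)
    have a5 : z ≠ u := fun h => h11 (h ▸ h5)
    have a6 : z ≠ v := fun h => h10 (h ▸ h5.symm)
    have := h1.ne
    have := h2.ne
    have := h5.ne
    intro i j hij
    fin_cases i <;> fin_cases j <;> simp_all
  · intro i j
    change G.Adj (![x, y, z, u, v] i) (![x, y, z, u, v] j) ↔ _
    have b1 := h1.symm
    have b2 := h2.symm
    have b5 := h5.symm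
    have b4 : ¬ G.Adj z x := fun h => h4 h.symm
    have b6 : ¬ G.Adj u x := fun h => h6 h.symm
    have b7 : ¬ G.Adj v x := fun h => h7 h.symm
    have b8 : ¬ G.Adj u y := fun h => h8 h.symm
    have b9 : ¬ G.Adj v y := fun h => h9 h.symm
    have b10 : ¬ G.Adj u z := fun h => h10 h.symm
    have b11 : ¬ G.Adj v z := fun h => h11 h.symm
    fin_cases i <;> fin_cases j <;> simp [P3P2, *]

theorem wfree_of {V : Type*} (G : SimpleGraph V) (hW : IsEmpty (W4 ↪g G)) : WFree G := by
  intro p q r s h h1 h2 h3 h4 h5 h6 h7 h8 h9 h10 h11 h12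
  refine hW.elim ⟨⟨![p, q, r, s, h], ?_⟩, ?_⟩
  · have := h1.ne
    have := h2.ne
    have := h3.ne
    have := h4.ne
    have := h9.ne
    have := h10.ne
    have := h11.ne
    have := h12.ne
    intro i j hij
    fin_cases i <;> fin_cases j <;> simp_all
  · intro i j
    change G.Adj (![p, q, r, s, h] i) (![p, q, r, s, h] j) ↔ _
    have b1 := h1.symm
    have b2 := h2.symm
    have b3 := h3.symm
    have b4 := h4.symm
    have b9 := h9.symm
    have b10 := h10.symm
    have b11 := h11.symm
    have b12 := h12.symm
    have b7 : ¬ G.Adj r p := fun h => h7 h.symm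
    have b8 : ¬ G.Adj s q := fun h => h8 h.symm
    fin_cases i <;> fin_cases j <;> simp [W4, *]

theorem kfree_of {V : Type*} (G : SimpleGraph V) (hK : G.CliqueFree 5) : KFree G := by
  classical
  intro p q r s t h1 h2 h3 h4 h5 h6 h7 h8 h9 h10
  apply hK {p, q, r, s, t}
  have := h1.ne
  have := h2.ne
  have := h3.ne
  have := h4.ne
  have := h5.ne
  have := h6.ne
  have := h7.ne
  have := h8.ne
  have := h9.ne
  have := h10.ne
  constructor
  · simp [SimpleGraph.isClique_iff, Set.Pairwise]
    grind [G.adj_comm]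
  · simp [*]

/-- The set `s` can be properly coloured with `n` colours. -/
def Col {V : Type*} (G : SimpleGraph V) (s : Set V) (n : ℕ) : Prop :=
  ∃ f : V → ℕ, (∀ x ∈ s, f x < n) ∧ ∀ x ∈ s, ∀ y ∈ s, G.Adj x y → f x ≠ f y

section
variable {V : Type*} {G : SimpleGraph V}

theorem Col.mono {s t : Set V} {n m : ℕ} (h : Col G t n) (hs : s ⊆ t) (hn : n ≤ m) :
    Col G s m := by
  obtain ⟨f, h1, h2⟩ := h
  exact ⟨f, fun x hx => (h1 x (hs hx)).trans_le hn, fun x hx y hy => h2 x (hs hx) y (hs hy)⟩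

theorem Col.union {s t : Set V} {n m : ℕ} (h : Col G s n) (h' : Col G t m) :
    Col G (s ∪ t) (n + m) := by
  classical
  obtain ⟨f, h1, h2⟩ := h
  obtain ⟨g, h3, h4⟩ := h'
  refine ⟨fun x => if x ∈ s then f x else n + g x, ?_, ?_⟩
  · intro x hx
    have := h1 x
    have := h3 x
    grind
  · intro x hx y hy hxy
    have := h1 x
    have := h1 y
    have := h2 x
    have := h4 x
    grind

theorem Col.anti {s t : Set V} {n : ℕ} (h : Col G s n) (h' : Col G t n)
    (hst : ∀ x ∈ s, ∀ y ∈ t, ¬ G.Adj x y) : Col G (s ∪ t) n := by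
  classical
  obtain ⟨f, h1, h2⟩ := h
  obtain ⟨g, h3, h4⟩ := h'
  refine ⟨fun x => if x ∈ s then f x else g x, ?_, ?_⟩
  · intro x hx
    have := h1 x
    have := h3 x
    grind
  · intro x hx y hy hxy
    have := h2 x
    have := h4 x
    have := hst x
    have := hst y
    have := hxy.symm
    grind

theorem Col.indep {s : Set V} (h : ∀ x ∈ s, ∀ y ∈ s, ¬ G.Adj x y) : Col G s 1 :=
  ⟨fun _ => 0, fun _ _ => one_pos, fun x hx y hy hxy => (h x hx y hy hxy).elim⟩

theorem Col.pair (a b : V) : Col G {a, b} 2 := by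
  classical
  refine ⟨fun x => if x = a then 0 else 1, ?_, ?_⟩
  · intro x _
    grind
  · intro x hx y hy hxy
    have := hxy.ne
    simp only [Set.mem_insert_iff, Set.mem_singleton_iff] at hx hy
    grind

/-- `s` induces a disjoint union of cliques. -/
def Cluster (G : SimpleGraph V) (s : Set V) : Prop :=
  ∀ x ∈ s, ∀ y ∈ s, ∀ z ∈ s, G.Adj x y → G.Adj y z → x ≠ z → G.Adj x z

theorem Cluster.mono {s t : Set V} (h : Cluster G t) (hs : s ⊆ t) : Cluster G s :=
  fun x hx y hy z hz => h x (hs hx) y (hs hy) z (hs hz)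

theorem Cluster.col [Fintype V] {s : Set V} {n : ℕ} (h : Cluster G s)
    (hn : ∀ Q : Finset V, (∀ x ∈ Q, x ∈ s) → (∀ x ∈ Q, ∀ y ∈ Q, x ≠ y → G.Adj x y) →
      Q.card ≤ n) : Col G s n := by
  classical
  let e := Fintype.equivFin V
  let C : V → Finset V := fun x => {y | y ∈ s ∧ (y = x ∨ G.Adj x y)}
  have hC : ∀ x y, y ∈ C x ↔ y ∈ s ∧ (y = x ∨ G.Adj x y) := by simp [C]
  have hlt : ∀ x ∈ s, ∀ y ∈ s, G.Adj x y → e x < e y →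
      ((C x).filter (fun z => e z < e x)).card < ((C y).filter (fun z => e z < e y)).card := by
    intro x hx y hy hxy hl
    apply Finset.card_lt_card
    rw [Finset.ssubset_iff_of_subset]
    · refine ⟨x, ?_, ?_⟩
      · simp [hC, hx, hxy.symm, hl]
      · simp
    · intro z
      simp only [Finset.mem_filter, hC]
      rintro ⟨⟨hz, h1⟩, h2⟩
      refine ⟨⟨hz, ?_⟩, h2.trans hl⟩
      rcases h1 with rfl | h1
      · exact Or.inr hxy.symm
      · by_cases hzy : z = y
        · exact Or.inl hzy
        · exact Or.inr (h y hy x hx z hz hxy.symm h1 (Ne.symm hzy))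
  refine ⟨fun x => ((C x).filter (fun z => e z < e x)).card, ?_, ?_⟩
  · intro x hx
    refine lt_of_lt_of_le (Finset.card_lt_card ?_) (hn (C x) ?_ ?_)
    · rw [Finset.filter_ssubset]
      exact ⟨x, by simp [hC, hx], by simp⟩
    · intro y hy
      exact ((hC x y).1 hy).1
    · intro y hy z hz hyz
      obtain ⟨hy, h1⟩ := (hC x y).1 hy
      obtain ⟨hz, h2⟩ := (hC x z).1 hz
      rcases h1 with rfl | h1
      · rcases h2 with rfl | h2
        · exact (hyz rfl).elim
        · exact h2
      · rcases h2 with rfl | h2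
        · exact h1.symm
        · exact h y hy x hx z hz h1.symm h2 hyz
  · intro x hx y hy hxy
    rcases lt_trichotomy (e x) (e y) with hl | hl | hl
    · exact (hlt x hx y hy hxy hl).ne
    · exact (hxy.ne (e.injective hl)).elim
    · exact (hlt y hy x hx hxy.symm hl).ne'

theorem four_of_card {Q : Finset V} (h : 3 < Q.card) :
    ∃ p ∈ Q, ∃ q ∈ Q, ∃ r ∈ Q, ∃ s ∈ Q, p ≠ q ∧ p ≠ r ∧ p ≠ s ∧ q ≠ r ∧ q ≠ s ∧ r ≠ s := by
  classical
  obtain ⟨p, hp⟩ := Finset.card_pos.1 (by omega : 0 < Q.card)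
  have : 2 < (Q.erase p).card := by rw [Finset.card_erase_of_mem hp]; omega
  obtain ⟨q, hq, r, hr, s, hs, h1, h2, h3⟩ := Finset.two_lt_card.1 this
  simp only [Finset.mem_erase] at hq hr hs
  exact ⟨p, hp, q, hq.2, r, hr.2, s, hs.2, hq.1.symm, hr.1.symm, hs.1.symm, h1, h2, h3⟩

/-- `s` contains no triangle -/
def NoK3 (G : SimpleGraph V) (s : Set V) : Prop :=
  ∀ p ∈ s, ∀ q ∈ s, ∀ r ∈ s, G.Adj p q → G.Adj p r → G.Adj q r → False

/-- `s` contains no four pairwise adjacent vertices -/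
def NoK4 (G : SimpleGraph V) (s : Set V) : Prop :=
  ∀ p ∈ s, ∀ q ∈ s, ∀ r ∈ s, ∀ t ∈ s, G.Adj p q → G.Adj p r → G.Adj p t →
    G.Adj q r → G.Adj q t → G.Adj r t → False

theorem Cluster.col2 [Fintype V] {s : Set V} (h : Cluster G s) (hk : NoK3 G s) : Col G s 2 := by
  refine h.col fun Q hQ hc => ?_
  by_contra hlt
  obtain ⟨p, hp, q, hq, r, hr, h1, h2, h3⟩ := Finset.two_lt_card.1 (not_le.1 hlt)
  exact hk p (hQ p hp) q (hQ q hq) r (hQ r hr) (hc _ hp _ hq h1) (hc _ hp _ hr h2)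
    (hc _ hq _ hr h3)

theorem Cluster.col3 [Fintype V] {s : Set V} (h : Cluster G s) (hk : NoK4 G s) : Col G s 3 := by
  refine h.col fun Q hQ hc => ?_
  by_contra hlt
  obtain ⟨p, hp, q, hq, r, hr, t, ht, h1, h2, h3, h4, h5, h6⟩ := four_of_card (not_le.1 hlt)
  exact hk p (hQ p hp) q (hQ q hq) r (hQ r hr) t (hQ t ht) (hc _ hp _ hq h1) (hc _ hp _ hr h2)
    (hc _ hp _ ht h3) (hc _ hq _ hr h4) (hc _ hq _ ht h5) (hc _ hr _ ht h6)

theorem Cluster.col4 [Fintype V] {s : Set V} (h : Cluster G s) (hk : G.CliqueFree 5) :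
    Col G s 4 := by
  refine h.col fun Q hQ hc => ?_
  by_contra hlt
  obtain ⟨R, hR, hcard⟩ := Finset.exists_subset_card_eq (show 5 ≤ Q.card by omega)
  exact hk R ⟨fun x hx y hy hxy => hc x (hR hx) y (hR hy) hxy, hcard⟩

/-- Vertices adjacent neither to `a` nor to `b`. -/
def Miss (G : SimpleGraph V) (a b : V) : Set V := {v | ¬ G.Adj a v ∧ ¬ G.Adj b v}

theorem miss_cluster (hP : PFree G) {a b : V} (hab : G.Adj a b) : Cluster G (Miss G a b) := by
  intro x hx y hy z hz hxy hyz hne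
  by_contra hxz
  simp only [Miss, Set.mem_ofPred_eq] at hx hy hz
  exact hP x y z a b hxy hyz hne hxz hab (fun h => hx.1 h.symm) (fun h => hx.2 h.symm)
    (fun h => hy.1 h.symm) (fun h => hy.2 h.symm) (fun h => hz.1 h.symm) (fun h => hz.2 h.symm)

theorem Col.addEdge {X : Set V} {a b : V} {n : ℕ} (h : Col G X n) (hX : X ⊆ Miss G a b)
    (hn : 2 ≤ n) : Col G ({a, b} ∪ X) n := by
  refine ((Col.pair a b).mono subset_rfl hn).anti h ?_
  intro x hx y hy
  have := hX hy
  simp only [Miss, Set.mem_ofPred_eq] at this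
  rcases hx with rfl | rfl
  · exact this.1
  · exact this.2

/-- A vertex distinguishing `a` from `b` meets every edge of `Miss a b`. -/
theorem meets (hP : PFree G) {a b x p q : V} (hab : G.Adj a b) (hxa : x ≠ a) (hxb : x ≠ b)
    (hx : (G.Adj a x ∧ ¬ G.Adj b x) ∨ (¬ G.Adj a x ∧ G.Adj b x))
    (hp : p ∈ Miss G a b) (hq : q ∈ Miss G a b) (hpq : G.Adj p q) :
    G.Adj p x ∨ G.Adj q x := by
  simp only [Miss, Set.mem_ofPred_eq] at hp hq
  by_contra! hcon
  have c1 : ¬ G.Adj x p := fun h => hcon.1 h.symm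
  have c2 : ¬ G.Adj x q := fun h => hcon.2 h.symm
  rcases hx with hx | hx
  · exact hP x a b p q hx.1.symm hab hxb (fun h => hx.2 h.symm) hpq c1 c2 hp.1 hq.1 hp.2 hq.2
  · exact hP x b a p q hx.2.symm hab.symm hxa (fun h => hx.1 h.symm) hpq c1 c2 hp.2 hq.2 hp.1 hq.1

theorem cross (hW : WFree G) {a b c x y : V} (hab : G.Adj a b) (hca : G.Adj c a) (hcb : G.Adj c b)
    (hxb : x ≠ b) (hya : y ≠ a) (h1 : G.Adj a x) (h2 : ¬ G.Adj b x) (h3 : ¬ G.Adj a y)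
    (h4 : G.Adj b y) (h5 : G.Adj c x) (h6 : G.Adj c y) : ¬ G.Adj x y := fun hxy =>
  hW x y b a c hxy h4.symm hab.symm h1 hxb hya (fun h => h2 h.symm) (fun h => h3 h.symm)
    h5 h6 hcb hca

/-- `a, b, c, d` form a clique -/
structure K4 (G : SimpleGraph V) (a b c d : V) : Prop where
  ab : G.Adj a b
  ac : G.Adj a c
  ad : G.Adj a d
  bc : G.Adj b c
  bd : G.Adj b d
  cd : G.Adj c d

/-- Vertices outside `{a, b, c, d}` with at most one non-neighbour in it. -/
def TT (G : SimpleGraph V) (a b c d : V) : Set V :=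
  {v | (v ≠ a ∧ v ≠ b ∧ v ≠ c ∧ v ≠ d) ∧ (G.Adj a v ∨ G.Adj b v) ∧ (G.Adj a v ∨ G.Adj c v) ∧
    (G.Adj a v ∨ G.Adj d v) ∧ (G.Adj b v ∨ G.Adj c v) ∧ (G.Adj b v ∨ G.Adj d v) ∧
    (G.Adj c v ∨ G.Adj d v)}

theorem TT_cases (hK : KFree G) {a b c d : V} (k : K4 G a b c d) {x : V} (hx : x ∈ TT G a b c d) :
    (¬ G.Adj a x ∧ G.Adj b x ∧ G.Adj c x ∧ G.Adj d x) ∨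
    (G.Adj a x ∧ ¬ G.Adj b x ∧ G.Adj c x ∧ G.Adj d x) ∨
    (G.Adj a x ∧ G.Adj b x ∧ ¬ G.Adj c x ∧ G.Adj d x) ∨
    (G.Adj a x ∧ G.Adj b x ∧ G.Adj c x ∧ ¬ G.Adj d x) := by
  have := hK a b c d x k.ab k.ac k.ad
  have := k.bc
  have := k.bd
  have := k.cd
  simp only [TT, Set.mem_ofPred_eq] at hx
  grind

theorem TT_indep (hW : WFree G) (hK : KFree G) {a b c d : V} (k : K4 G a b c d) :
    ∀ x ∈ TT G a b c d, ∀ y ∈ TT G a b c d, ¬ G.Adj x y := by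
  intro x hx y hy hxy
  obtain ⟨ab, ac, ad, bc, bd, cd⟩ := k
  have k : K4 G a b c d := ⟨ab, ac, ad, bc, bd, cd⟩
  obtain ⟨⟨xa, xb, xc, xd⟩, -⟩ := id hx
  obtain ⟨⟨ya, yb, yc, yd⟩, -⟩ := id hy
  rcases TT_cases hK k hx with ⟨x1, x2, x3, x4⟩ | ⟨x1, x2, x3, x4⟩ | ⟨x1, x2, x3, x4⟩ |
      ⟨x1, x2, x3, x4⟩ <;>
    rcases TT_cases hK k hy with ⟨y1, y2, y3, y4⟩ | ⟨y1, y2, y3, y4⟩ | ⟨y1, y2, y3, y4⟩ |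
      ⟨y1, y2, y3, y4⟩
  · exact hK b c d x y bc bd x2 y2 cd x3 y3 x4 y4 hxy
  · exact cross hW ab.symm bc.symm ac.symm xa yb x2 x1 y2 y1 x3 y3 hxy
  · exact cross hW ac.symm bc ab.symm xa yc x3 x1 y3 y1 x2 y2 hxy
  · exact cross hW ad.symm bd ab.symm xa yd x4 x1 y4 y1 x2 y2 hxy
  · exact cross hW ab ac.symm bc.symm xb ya x1 x2 y1 y2 x3 y3 hxy
  · exact hK a c d x y ac ad x1 y1 cd x3 y3 x4 y4 hxy
  · exact cross hW bc.symm ac ab xb yc x3 x2 y3 y2 x1 y1 hxy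
  · exact cross hW bd.symm ad ab xb yd x4 x2 y4 y2 x1 y1 hxy
  · exact cross hW ac ab.symm bc xc ya x1 x3 y1 y3 x2 y2 hxy
  · exact cross hW bc ab ac xc yb x2 x3 y2 y3 x1 y1 hxy
  · exact hK a b d x y ab ad x1 y1 bd x2 y2 x4 y4 hxy
  · exact cross hW cd.symm ad ac xc yd x4 x3 y4 y3 x1 y1 hxy
  · exact cross hW ad ab.symm bd xd ya x1 x4 y1 y4 x2 y2 hxy
  · exact cross hW bd ab ad xd yb x2 x4 y2 y4 x1 y1 hxy
  · exact cross hW cd ac ad xd yc x3 x4 y3 y4 x1 y1 hxy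
  · exact hK a b c x y ab ac x1 y1 bc x2 y2 x3 y3 hxy

/-- A vertex distinguishing `a` and `b` misses at most one vertex of a 4-clique of `Miss a b`. -/
theorem mem_TT (hP : PFree G) {a b p q r t x : V} (hab : G.Adj a b) (k : K4 G p q r t)
    (hp : p ∈ Miss G a b) (hq : q ∈ Miss G a b) (hr : r ∈ Miss G a b) (ht : t ∈ Miss G a b)
    (hxa : x ≠ a) (hxb : x ≠ b)
    (hx : (G.Adj a x ∧ ¬ G.Adj b x) ∨ (¬ G.Adj a x ∧ G.Adj b x)) : x ∈ TT G p q r t := by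
  have hm : ∀ y ∈ Miss G a b, x ≠ y := by
    rintro y hy rfl
    simp only [Miss, Set.mem_ofPred_eq] at hy
    tauto
  exact ⟨⟨hm p hp, hm q hq, hm r hr, hm t ht⟩, meets hP hab hxa hxb hx hp hq k.ab,
    meets hP hab hxa hxb hx hp hr k.ac, meets hP hab hxa hxb hx hp ht k.ad,
    meets hP hab hxa hxb hx hq hr k.bc, meets hP hab hxa hxb hx hq ht k.bd,
    meets hP hab hxa hxb hx hr ht k.cd⟩

/-- Vertices outside `{p, q, r}` with at most one non-neighbour in it. -/
def T3 (G : SimpleGraph V) (p q r : V) : Set V :=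
  {v | (v ≠ p ∧ v ≠ q ∧ v ≠ r) ∧ (G.Adj p v ∨ G.Adj q v) ∧ (G.Adj p v ∨ G.Adj r v) ∧
    (G.Adj q v ∨ G.Adj r v)}

/-- Adjacent vertices of `T3` do not miss distinct vertices. -/
theorem T3_pair (hW : WFree G) {p q r x y : V} (pq : G.Adj p q) (pr : G.Adj p r) (qr : G.Adj q r)
    (hx : x ∈ T3 G p q r) (hy : y ∈ T3 G p q r) (hxy : G.Adj x y) :
    (G.Adj p x ∨ G.Adj q y) ∧ (G.Adj p x ∨ G.Adj r y) ∧ (G.Adj q x ∨ G.Adj p y) ∧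
    (G.Adj q x ∨ G.Adj r y) ∧ (G.Adj r x ∨ G.Adj p y) ∧ (G.Adj r x ∨ G.Adj q y) := by
  obtain ⟨⟨xp, xq, xr⟩, x1, x2, x3⟩ := hx
  obtain ⟨⟨yp, yq, yr⟩, y1, y2, y3⟩ := hy
  refine ⟨?_, ?_, ?_, ?_, ?_, ?_⟩ <;> by_contra! hc
  · exact cross hW pq.symm qr.symm pr.symm xp yq (x1.resolve_left hc.1) hc.1 hc.2
      (y1.resolve_right hc.2) (x2.resolve_left hc.1) (y3.resolve_left hc.2) hxy
  · exact cross hW pr.symm qr pq.symm xp yr (x2.resolve_left hc.1) hc.1 hc.2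
      (y2.resolve_right hc.2) (x1.resolve_left hc.1) (y3.resolve_right hc.2) hxy
  · exact cross hW pq pr.symm qr.symm xq yp (x1.resolve_right hc.1) hc.1 hc.2
      (y1.resolve_left hc.2) (x3.resolve_left hc.1) (y2.resolve_left hc.2) hxy
  · exact cross hW qr.symm pr pq xq yr (x3.resolve_left hc.1) hc.1 hc.2
      (y3.resolve_right hc.2) (x1.resolve_right hc.1) (y2.resolve_right hc.2) hxy
  · exact cross hW pr pq.symm qr xr yp (x2.resolve_right hc.1) hc.1 hc.2
      (y2.resolve_left hc.2) (x3.resolve_right hc.1) (y1.resolve_left hc.2) hxy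
  · exact cross hW qr pq pr xr yq (x3.resolve_right hc.1) hc.1 hc.2
      (y3.resolve_left hc.2) (x2.resolve_right hc.1) (y1.resolve_right hc.2) hxy

theorem T3_triangle (hW : WFree G) (hK : KFree G) {p q r x y z : V} (pq : G.Adj p q)
    (pr : G.Adj p r) (qr : G.Adj q r) (hx : x ∈ T3 G p q r) (hy : y ∈ T3 G p q r)
    (hz : z ∈ T3 G p q r) (xy : G.Adj x y) (xz : G.Adj x z) (yz : G.Adj y z) : False := by
  obtain ⟨a1, a2, a3, a4, a5, a6⟩ := T3_pair hW pq pr qr hx hy xy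
  obtain ⟨b1, b2, b3, b4, b5, b6⟩ := T3_pair hW pq pr qr hx hz xz
  obtain ⟨c1, c2, c3, c4, c5, c6⟩ := T3_pair hW pq pr qr hy hz yz
  obtain ⟨-, x1, x2, x3⟩ := hx
  obtain ⟨-, y1, y2, y3⟩ := hy
  obtain ⟨-, z1, z2, z3⟩ := hz
  have k1 := hK p q x y z pq
  have k2 := hK p r x y z pr
  have k3 := hK q r x y z qr
  grind

theorem mem_T3 (hP : PFree G) {a b p q r x : V} (hab : G.Adj a b) (pq : G.Adj p q)
    (pr : G.Adj p r) (qr : G.Adj q r)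
    (hp : p ∈ Miss G a b) (hq : q ∈ Miss G a b) (hr : r ∈ Miss G a b)
    (hxa : x ≠ a) (hxb : x ≠ b)
    (hx : (G.Adj a x ∧ ¬ G.Adj b x) ∨ (¬ G.Adj a x ∧ G.Adj b x)) : x ∈ T3 G p q r := by
  have hm : ∀ y ∈ Miss G a b, x ≠ y := by
    rintro y hy rfl
    simp only [Miss, Set.mem_ofPred_eq] at hy
    tauto
  exact ⟨⟨hm p hp, hm q hq, hm r hr⟩, meets hP hab hxa hxb hx hp hq pq,
    meets hP hab hxa hxb hx hp hr pr, meets hP hab hxa hxb hx hq hr qr⟩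

theorem NoK4.of_not {s : Set V} (h : ¬ NoK4 G s) :
    ∃ p ∈ s, ∃ q ∈ s, ∃ r ∈ s, ∃ t ∈ s, K4 G p q r t := by
  by_contra hc
  refine h fun p hp q hq r hr t ht h1 h2 h3 h4 h5 h6 =>
    hc ⟨p, hp, q, hq, r, hr, t, ht, ⟨h1, h2, h3, h4, h5, h6⟩⟩

/-- Case 2: the vertices adjacent to exactly `a, b` contain an edge. -/
theorem case2 [Fintype V] (hP : PFree G) (hW : WFree G) (hF : G.CliqueFree 5) {a b c d u v : V}
    (k : K4 G a b c d) (huv : G.Adj u v)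
    (hu : G.Adj a u ∧ G.Adj b u ∧ ¬ G.Adj c u ∧ ¬ G.Adj d u)
    (hv : G.Adj a v ∧ G.Adj b v ∧ ¬ G.Adj c v ∧ ¬ G.Adj d v) : Col G Set.univ 8 := by
  have hK := kfree_of G hF
  obtain ⟨ab, ac, ad, bc, bd, cd⟩ := id k
  have ba := ab.symm
  have ca := ac.symm
  have da := ad.symm
  have cb := bc.symm
  have db := bd.symm
  have dc := cd.symm
  have hE : ∀ y, y ≠ a → y ≠ b → y ≠ c → y ≠ d →
      ((G.Adj a y ∧ ¬ G.Adj b y) ∨ (¬ G.Adj a y ∧ G.Adj b y)) →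
      ((G.Adj c y ∧ ¬ G.Adj d y) ∨ (¬ G.Adj c y ∧ G.Adj d y)) → False := by
    intro y ya yb yc yd h1 h2
    have key : ∀ w, (G.Adj a w ∧ G.Adj b w ∧ ¬ G.Adj c w ∧ ¬ G.Adj d w) → ¬ G.Adj w y := by
      rintro w ⟨w1, w2, w3, w4⟩
      have wc : w ≠ c := by rintro rfl; exact w4 dc
      have wd : w ≠ d := by rintro rfl; exact w3 cd
      rcases h1 with h1 | h1 <;> rcases h2 with h2 | h2
      · exact cross hW bc ab ac wc yb w2 w3 h1.2 h2.1 w1 h1.1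
      · exact cross hW bd ab ad wd yb w2 w4 h1.2 h2.2 w1 h1.1
      · exact cross hW ac ba bc wc ya w1 w3 h1.1 h2.1 w2 h1.2
      · exact cross hW ad ba bd wd ya w1 w4 h1.1 h2.2 w2 h1.2
    rcases meets hP cd yc yd h2 ⟨hu.2.2.1, hu.2.2.2⟩ ⟨hv.2.2.1, hv.2.2.2⟩ huv with h | h
    · exact key u hu h
    · exact key v hv h
  have hT := Col.indep (TT_indep hW hK k)
  by_cases h : NoK4 G {w | w ∈ Miss G c d ∧ (G.Adj a w ∨ G.Adj b w)}
  · have h1 := ((miss_cluster hP cd).mono (fun w hw => hw.1)).col3 h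
    have h1 := h1.addEdge (a := c) (b := d) (fun w hw => hw.1) (by norm_num)
    have h2 := ((miss_cluster hP ab).col4 hF).addEdge (a := a) (b := b) subset_rfl (by norm_num)
    refine ((hT.union h1).union h2).mono ?_ le_rfl
    intro w _
    have := hE w
    simp only [TT, Miss, Set.mem_union, Set.mem_ofPred_eq, Set.mem_insert_iff,
      Set.mem_singleton_iff]
    grind
  · obtain ⟨p, hp, q, hq, r, hr, t, ht, hk⟩ := NoK4.of_not h
    have hD : ∀ x, x ≠ c → x ≠ d → ((G.Adj c x ∧ ¬ G.Adj d x) ∨ (¬ G.Adj c x ∧ G.Adj d x)) →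
        x ∈ TT G p q r t := fun x hc hd hx => mem_TT hP cd hk hp.1 hq.1 hr.1 ht.1 hc hd hx
    have hI := TT_indep hW hK hk
    have h' : NoK4 G {w | w ∈ Miss G a b ∧ (G.Adj c w ∨ G.Adj d w)} := by
      rintro x ⟨⟨xa, xb⟩, x1⟩ y ⟨⟨ya, yb⟩, y1⟩ z ⟨⟨za, zb⟩, z1⟩ w ⟨⟨wa, wb⟩, w1⟩ xy xz xw yz yw zw
      have hD' : ∀ x, ¬ G.Adj a x → (G.Adj c x ∨ G.Adj d x) → (G.Adj c x ∧ G.Adj d x) ∨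
          x ∈ TT G p q r t := by
        intro x xa x1
        by_cases hx : G.Adj c x ∧ G.Adj d x
        · exact Or.inl hx
        · refine Or.inr (hD x ?_ ?_ (by tauto))
          · rintro rfl; exact xa ac
          · rintro rfl; exact xa ad
      have k1 := hK c d x y z cd
      have k2 := hK c d x y w cd
      have k3 := hK c d x z w cd
      have k4 := hK c d y z w cd
      have i1 := fun h1 h2 => hI x h1 y h2 xy
      have i2 := fun h1 h2 => hI x h1 z h2 xz
      have i3 := fun h1 h2 => hI x h1 w h2 xw
      have i4 := fun h1 h2 => hI y h1 z h2 yz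
      have i5 := fun h1 h2 => hI y h1 w h2 yw
      have i6 := fun h1 h2 => hI z h1 w h2 zw
      have d1 := hD' x xa x1
      have d2 := hD' y ya y1
      have d3 := hD' z za z1
      have d4 := hD' w wa w1
      clear hD hD' hI hE hT h
      grind
    have h1 := ((miss_cluster hP ab).mono (fun w hw => hw.1)).col3 h'
    have h1 := h1.addEdge (a := a) (b := b) (fun w hw => hw.1) (by norm_num)
    have h2 := ((miss_cluster hP cd).col4 hF).addEdge (a := c) (b := d) subset_rfl (by norm_num)
    refine ((hT.union h1).union h2).mono ?_ le_rfl
    intro w _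
    have := hE w
    simp only [TT, Miss, Set.mem_union, Set.mem_ofPred_eq, Set.mem_insert_iff,
      Set.mem_singleton_iff]
    grind

/-- No edge between two vertices having the same two neighbours in `{a, b, c, d}`. -/
def NB (G : SimpleGraph V) (a b c d : V) : Prop :=
  ∀ x y, G.Adj x y →
    ¬ (G.Adj a x ∧ G.Adj b x ∧ ¬ G.Adj c x ∧ ¬ G.Adj d x ∧
       G.Adj a y ∧ G.Adj b y ∧ ¬ G.Adj c y ∧ ¬ G.Adj d y) ∧
    ¬ (G.Adj a x ∧ ¬ G.Adj b x ∧ G.Adj c x ∧ ¬ G.Adj d x ∧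
       G.Adj a y ∧ ¬ G.Adj b y ∧ G.Adj c y ∧ ¬ G.Adj d y) ∧
    ¬ (G.Adj a x ∧ ¬ G.Adj b x ∧ ¬ G.Adj c x ∧ G.Adj d x ∧
       G.Adj a y ∧ ¬ G.Adj b y ∧ ¬ G.Adj c y ∧ G.Adj d y) ∧
    ¬ (¬ G.Adj a x ∧ G.Adj b x ∧ G.Adj c x ∧ ¬ G.Adj d x ∧
       ¬ G.Adj a y ∧ G.Adj b y ∧ G.Adj c y ∧ ¬ G.Adj d y) ∧
    ¬ (¬ G.Adj a x ∧ G.Adj b x ∧ ¬ G.Adj c x ∧ G.Adj d x ∧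
       ¬ G.Adj a y ∧ G.Adj b y ∧ ¬ G.Adj c y ∧ G.Adj d y) ∧
    ¬ (¬ G.Adj a x ∧ ¬ G.Adj b x ∧ G.Adj c x ∧ G.Adj d x ∧
       ¬ G.Adj a y ∧ ¬ G.Adj b y ∧ G.Adj c y ∧ G.Adj d y)

/-- Exactly two neighbours in `{a, b, c}`, and not adjacent to `d`; or `d` itself. -/
def B1 (G : SimpleGraph V) (a b c d : V) : Set V :=
  {v | v = d ∨ (¬ G.Adj d v ∧ ((G.Adj a v ∧ G.Adj b v ∧ ¬ G.Adj c v) ∨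
    (G.Adj a v ∧ ¬ G.Adj b v ∧ G.Adj c v) ∨ (¬ G.Adj a v ∧ G.Adj b v ∧ G.Adj c v)))}

/-- Adjacent to `d` and exactly one of `{a, b, c}`. -/
def B2 (G : SimpleGraph V) (a b c d : V) : Set V :=
  {v | G.Adj d v ∧ ((G.Adj a v ∧ ¬ G.Adj b v ∧ ¬ G.Adj c v) ∨
    (¬ G.Adj a v ∧ G.Adj b v ∧ ¬ G.Adj c v) ∨ (¬ G.Adj a v ∧ ¬ G.Adj b v ∧ G.Adj c v))}

theorem B1_indep (hW : WFree G) {a b c d : V} (k : K4 G a b c d) (hB : NB G a b c d) :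
    ∀ x ∈ B1 G a b c d, ∀ y ∈ B1 G a b c d, ¬ G.Adj x y := by
  intro x hx y hy hxy
  obtain ⟨ab, ac, ad, bc, bd, cd⟩ := id k
  have ne : ∀ w, ¬ G.Adj d w → w ≠ a ∧ w ≠ b ∧ w ≠ c := by
    intro w hw
    refine ⟨?_, ?_, ?_⟩ <;> rintro rfl
    · exact hw ad.symm
    · exact hw bd.symm
    · exact hw cd.symm
  obtain ⟨n1, n2, n3, n4, n5, n6⟩ := hB x y hxy
  rcases hx with rfl | ⟨xd, hx⟩
  · rcases hy with rfl | ⟨yd, hy⟩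
    · exact hxy.ne rfl
    · exact yd hxy
  · rcases hy with rfl | ⟨yd, hy⟩
    · exact xd hxy.symm
    · obtain ⟨xa, xb, xc⟩ := ne x xd
      obtain ⟨ya, yb, yc⟩ := ne y yd
      rcases hx with ⟨x1, x2, x3⟩ | ⟨x1, x2, x3⟩ | ⟨x1, x2, x3⟩ <;>
        rcases hy with ⟨y1, y2, y3⟩ | ⟨y1, y2, y3⟩ | ⟨y1, y2, y3⟩
      · grind
      · exact cross hW bc ab ac xc yb x2 x3 y2 y3 x1 y1 hxy
      · exact cross hW ac ab.symm bc xc ya x1 x3 y1 y3 x2 y2 hxy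
      · exact cross hW bc.symm ac ab xb yc x3 x2 y3 y2 x1 y1 hxy
      · grind
      · exact cross hW ab ac.symm bc.symm xb ya x1 x2 y1 y2 x3 y3 hxy
      · exact cross hW ac.symm bc ab.symm xa yc x3 x1 y3 y1 x2 y2 hxy
      · exact cross hW ab.symm bc.symm ac.symm xa yb x2 x1 y2 y1 x3 y3 hxy
      · grind

theorem B2_indep (hW : WFree G) {a b c d : V} (k : K4 G a b c d) (hB : NB G a b c d) :
    ∀ x ∈ B2 G a b c d, ∀ y ∈ B2 G a b c d, ¬ G.Adj x y := by
  intro x hx y hy hxy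
  obtain ⟨ab, ac, ad, bc, bd, cd⟩ := id k
  have ne : ∀ w ∈ B2 G a b c d, w ≠ a ∧ w ≠ b ∧ w ≠ c := by
    rintro w ⟨-, hw⟩
    have := ab.symm
    have := ac.symm
    have := bc.symm
    refine ⟨?_, ?_, ?_⟩ <;> rintro rfl <;> grind
  obtain ⟨n1, n2, n3, n4, n5, n6⟩ := hB x y hxy
  obtain ⟨xa, xb, xc⟩ := ne x hx
  obtain ⟨ya, yb, yc⟩ := ne y hy
  obtain ⟨xd, hx⟩ := hx
  obtain ⟨yd, hy⟩ := hy
  rcases hx with ⟨x1, x2, x3⟩ | ⟨x1, x2, x3⟩ | ⟨x1, x2, x3⟩ <;>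
    rcases hy with ⟨y1, y2, y3⟩ | ⟨y1, y2, y3⟩ | ⟨y1, y2, y3⟩
  · grind
  · exact cross hW ab ad.symm bd.symm xb ya x1 x2 y1 y2 xd yd hxy
  · exact cross hW ac ad.symm cd.symm xc ya x1 x3 y1 y3 xd yd hxy
  · exact cross hW ab.symm bd.symm ad.symm xa yb x2 x1 y2 y1 xd yd hxy
  · grind
  · exact cross hW bc bd.symm cd.symm xc yb x2 x3 y2 y3 xd yd hxy
  · exact cross hW ac.symm cd.symm ad.symm xa yc x3 x1 y3 y1 xd yd hxy
  · exact cross hW bc.symm cd.symm bd.symm xb yc x3 x2 y3 y2 xd yd hxy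
  · grind

/-- Exactly one neighbour in `{a, b, c, d}`, which is `a` or `b`. -/
def S2 (G : SimpleGraph V) (a b c d : V) : Set V :=
  {v | v ∈ Miss G c d ∧ ((G.Adj a v ∧ ¬ G.Adj b v) ∨ (¬ G.Adj a v ∧ G.Adj b v))}

/-- At most one neighbour in `{a, b, c, d}`, which is `a` or `b`. -/
def S2Z (G : SimpleGraph V) (a b c d : V) : Set V :=
  {v | v ∈ Miss G c d ∧ ¬ (G.Adj a v ∧ G.Adj b v)}

theorem case1_i [Fintype V] (hP : PFree G) (hW : WFree G) (hF : G.CliqueFree 5) {a b c d : V}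
    (k : K4 G a b c d) (hB : NB G a b c d)
    (h : ∀ x ∈ S2 G a b c d, ∀ y ∈ S2 G a b c d, ¬ G.Adj x y) : Col G Set.univ 8 := by
  have hK := kfree_of G hF
  have hT := Col.indep (TT_indep hW hK k)
  have h1 := Col.indep (B1_indep hW k hB)
  have h2 := Col.indep (B2_indep hW k hB)
  have h3 : Col G ({c} ∪ S2 G a b c d) 1 := by
    refine Col.anti (Col.indep ?_) (Col.indep h) ?_
    · rintro x rfl y rfl
      exact G.loopless.irrefl _
    · rintro x rfl y hy
      exact hy.1.1
  have h4 := ((miss_cluster hP k.ab).col4 hF).addEdge (a := a) (b := b) subset_rfl (by norm_num)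
  refine ((((hT.union h1).union h2).union h3).union h4).mono ?_ le_rfl
  intro w _
  simp only [TT, B1, B2, S2, Miss, Set.mem_union, Set.mem_ofPred_eq, Set.mem_insert_iff,
    Set.mem_singleton_iff]
  clear hT h1 h2 h3 h4 h hB
  grind

theorem case1_iii [Fintype V] (hP : PFree G) (hW : WFree G) (hF : G.CliqueFree 5) {a b c d : V}
    (k : K4 G a b c d) (hB : NB G a b c d)
    (h : NoK3 G (S2 G a b c d)) (h' : NoK4 G (S2Z G c d a b)) : Col G Set.univ 8 := by
  have hK := kfree_of G hF
  have hT := Col.indep (TT_indep hW hK k)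
  have h1 := Col.indep (B1_indep hW k hB)
  have h2 := Col.indep (B2_indep hW k hB)
  have h3 := ((miss_cluster hP k.cd).mono (fun w hw => hw.1)).col2 h
  have h3 := h3.addEdge (a := c) (b := d) (fun w hw => hw.1) (by norm_num)
  have h4 := ((miss_cluster hP k.ab).mono (fun w hw => hw.1)).col3 h'
  have h4 := h4.addEdge (a := a) (b := b) (fun w hw => hw.1) (by norm_num)
  refine ((((hT.union h1).union h2).union h3).union h4).mono ?_ le_rfl
  intro w _
  simp only [TT, B1, B2, S2, S2Z, Miss, Set.mem_union, Set.mem_ofPred_eq, Set.mem_insert_iff,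
    Set.mem_singleton_iff]
  clear hT h1 h2 h3 h4 h h' hB
  grind

theorem S2_ne {a b c d x : V} (k : K4 G a b c d) (hx : x ∈ S2 G a b c d) : x ≠ a ∧ x ≠ b := by
  obtain ⟨⟨h1, h2⟩, -⟩ := hx
  constructor <;> rintro rfl
  · exact h1 k.ac.symm
  · exact h1 k.bc.symm

theorem S2_indep (hP : PFree G) (hW : WFree G) (hK : KFree G) {a b c d : V}
    (k : K4 G a b c d) (h : ¬ NoK4 G (S2Z G c d a b)) :
    ∀ x ∈ S2 G a b c d, ∀ y ∈ S2 G a b c d, ¬ G.Adj x y := by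
  obtain ⟨p, hp, q, hq, r, hr, t, ht, hk⟩ := NoK4.of_not h
  intro x hx y hy
  exact TT_indep hW hK hk x
    (mem_TT hP k.ab hk hp.1 hq.1 hr.1 ht.1 (S2_ne k hx).1 (S2_ne k hx).2 hx.2) y
    (mem_TT hP k.ab hk hp.1 hq.1 hr.1 ht.1 (S2_ne k hy).1 (S2_ne k hy).2 hy.2)

theorem case1 [Fintype V] (hP : PFree G) (hW : WFree G) (hF : G.CliqueFree 5) {a b c d : V}
    (k : K4 G a b c d) (hB : NB G a b c d) : Col G Set.univ 8 := by
  have hK := kfree_of G hF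
  have k' : K4 G c d a b :=
    ⟨k.cd, k.ac.symm, k.bc.symm, k.ad.symm, k.bd.symm, k.ab⟩
  have hB' : NB G c d a b := by
    intro x y hxy
    have := hB x y hxy
    grind
  by_cases h1 : NoK4 G (S2Z G c d a b)
  · by_cases h2 : NoK4 G (S2Z G a b c d)
    · by_cases h3 : NoK3 G (S2 G a b c d)
      · exact case1_iii hP hW hF k hB h3 h1
      · refine case1_iii hP hW hF k' hB' ?_ h2
        intro p hp q hq r hr pq pr qr
        apply h3
        intro x hx y hy z hz xy xz yz
        have hm : ∀ x ∈ S2 G a b c d, x ∈ T3 G p q r := fun x hx =>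
          mem_T3 hP k.ab pq pr qr hp.1 hq.1 hr.1 (S2_ne k hx).1 (S2_ne k hx).2 hx.2
        exact T3_triangle hW hK pq pr qr (hm x hx) (hm y hy) (hm z hz) xy xz yz
    · exact case1_i hP hW hF k' hB' (S2_indep hP hW hK k' h2)
  · exact case1_i hP hW hF k hB (S2_indep hP hW hK k h1)

theorem caseK4 [Fintype V] (hP : PFree G) (hW : WFree G) (hF : G.CliqueFree 5) {a b c d : V}
    (k : K4 G a b c d) : Col G Set.univ 8 := by
  by_contra hcon
  refine hcon (case1 hP hW hF k ?_)
  obtain ⟨ab, ac, ad, bc, bd, cd⟩ := id k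
  intro x y hxy
  refine ⟨?_, ?_, ?_, ?_, ?_, ?_⟩ <;> rintro ⟨x1, x2, x3, x4, y1, y2, y3, y4⟩ <;> apply hcon
  · exact case2 hP hW hF k hxy ⟨x1, x2, x3, x4⟩ ⟨y1, y2, y3, y4⟩
  · exact case2 hP hW hF (a := a) (b := c) (c := b) (d := d) ⟨ac, ab, ad, bc.symm, cd, bd⟩ hxy
      ⟨x1, x3, x2, x4⟩ ⟨y1, y3, y2, y4⟩
  · exact case2 hP hW hF (a := a) (b := d) (c := b) (d := c) ⟨ad, ab, ac, bd.symm, cd.symm, bc⟩ hxy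
      ⟨x1, x4, x2, x3⟩ ⟨y1, y4, y2, y3⟩
  · exact case2 hP hW hF (a := b) (b := c) (c := a) (d := d) ⟨bc, ab.symm, bd, ac.symm, cd, ad⟩ hxy
      ⟨x2, x3, x1, x4⟩ ⟨y2, y3, y1, y4⟩
  · exact case2 hP hW hF (a := b) (b := d) (c := a) (d := c)
      ⟨bd, ab.symm, bc, ad.symm, cd.symm, ac⟩ hxy ⟨x2, x4, x1, x3⟩ ⟨y2, y4, y1, y3⟩
  · exact case2 hP hW hF (a := c) (b := d) (c := a) (d := b)
      ⟨cd, ac.symm, bc.symm, ad.symm, bd.symm, ab⟩ hxy ⟨x3, x4, x1, x2⟩ ⟨y3, y4, y1, y2⟩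

theorem caseK3 [Fintype V] (hP : PFree G) (hW : WFree G) (hF : NoK4 G Set.univ) {a b c : V}
    (ab : G.Adj a b) (ac : G.Adj a c) (bc : G.Adj b c) : Col G Set.univ 8 := by
  have hK : ∀ p q r t, G.Adj p q → G.Adj p r → G.Adj p t →
      G.Adj q r → G.Adj q t → G.Adj r t → False := fun p q r t =>
    hF p trivial q trivial r trivial t trivial
  have hT : Col G (T3 G a b c) 1 := by
    apply Col.indep
    intro x hx y hy hxy
    have := T3_pair hW ab ac bc hx hy hxy
    obtain ⟨-, x1, x2, x3⟩ := hx
    obtain ⟨-, y1, y2, y3⟩ := hy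
    have k1 := hK a b x y ab
    have k2 := hK a c x y ac
    have k3 := hK b c x y bc
    grind
  have h1 : Col G {w | w ∈ Miss G b c ∧ G.Adj a w} 2 := by
    refine ((miss_cluster hP bc).mono (fun w hw => hw.1)).col2 ?_
    rintro p ⟨-, hp⟩ q ⟨-, hq⟩ r ⟨-, hr⟩ pq pr qr
    exact hK a p q r hp hq hr pq pr qr
  have h1 := h1.addEdge (a := b) (b := c) (fun w hw => hw.1) le_rfl
  have h2 : Col G {w | w ∈ Miss G a c ∧ G.Adj b w} 2 := by
    refine ((miss_cluster hP ac).mono (fun w hw => hw.1)).col2 ?_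
    rintro p ⟨-, hp⟩ q ⟨-, hq⟩ r ⟨-, hr⟩ pq pr qr
    exact hK b p q r hp hq hr pq pr qr
  have h3 : Col G (Miss G a b) 3 :=
    (miss_cluster hP ab).col3 fun p _ q _ r _ t _ => hK p q r t
  have h3 := h3.addEdge (a := a) (b := b) subset_rfl (by norm_num)
  refine (((hT.union h1).union h2).union h3).mono ?_ le_rfl
  intro w _
  simp only [T3, Miss, Set.mem_union, Set.mem_ofPred_eq, Set.mem_insert_iff,
    Set.mem_singleton_iff]
  clear hT h1 h2 h3
  grind

theorem caseK2 [Fintype V] (hP : PFree G) (hF : NoK3 G Set.univ) {a b : V}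
    (ab : G.Adj a b) : Col G Set.univ 8 := by
  have hK : ∀ p q r, G.Adj p q → G.Adj p r → G.Adj q r → False := fun p q r =>
    hF p trivial q trivial r trivial
  have h1 : Col G {w | G.Adj a w} 1 := Col.indep fun x hx y hy hxy => hK a x y hx hy hxy
  have h2 : Col G {w | G.Adj b w} 1 := Col.indep fun x hx y hy hxy => hK b x y hx hy hxy
  have h3 : Col G (Miss G a b) 2 := (miss_cluster hP ab).col2 fun p _ q _ r _ => hK p q r
  refine ((h1.union h2).union h3).mono ?_ (by norm_num)
  intro w _
  simp only [Miss, Set.mem_union, Set.mem_ofPred_eq]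
  tauto

theorem col_univ [Fintype V] (hP : PFree G) (hW : WFree G) (hF : G.CliqueFree 5) :
    Col G Set.univ 8 := by
  by_contra hcon
  have h4 : NoK4 G Set.univ := fun p _ q _ r _ t _ h1 h2 h3 h4 h5 h6 =>
    hcon (caseK4 hP hW hF ⟨h1, h2, h3, h4, h5, h6⟩)
  have h3 : NoK3 G Set.univ := fun p _ q _ r _ h1 h2 h3 => hcon (caseK3 hP hW h4 h1 h2 h3)
  exact hcon ((Col.indep fun x _ y _ hxy => hcon (caseK2 hP h3 hxy)).mono subset_rfl (by norm_num))
end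

theorem stmt4 {V : Type*} [Fintype V] (G : SimpleGraph V)
    (hP : IsEmpty (P3P2 ↪g G)) (hW : IsEmpty (W4 ↪g G)) (hK5 : G.CliqueFree 5) :
    G.chromaticNumber ≤ 8 := by
  obtain ⟨f, h1, h2⟩ := col_univ (pfree_of G hP) (wfree_of G hW) hK5
  have hc : G.Colorable 8 :=
    ⟨SimpleGraph.Coloring.mk (fun v => (⟨f v, h1 v trivial⟩ : Fin 8)) fun {x y} hxy h =>
      h2 x trivial y trivial hxy (congrArg Fin.val h)⟩
  exact hc.chromaticNumber_le
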